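/- Termination-insensitive noninterference (TINI) is a 2-hypersafety property: for every behavior b ∉ TINI there exists an observation o containing at most 2 finite prefixes such that o ≤ b and every behavior b' with o ≤ b' satisfies b' ∉ TINI. -/

import Mathlib

/-- Concrete trace model: a trace is either a terminated trace (finite list of
events) or an infinite stream of events. -/
inductive Trc (E : Type) : Type where
  | term : List E → Trc E
  | inf  : (Nat → E) → Trc E

/-- Finite prefixes: incomplete or complete, in both cases a finite list of events. -/
inductive Pref (E : Type) : Type where
  | incomplete : List E → Pref E
  | complete   : List E → Pref E
deriving DecidableEq

/-- The prefix relation m ≤ t. -/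
def prefOf {E : Type} : Pref E → Trc E → Prop
  | Pref.incomplete l, Trc.term l' => l <+: l'
  | Pref.incomplete l, Trc.inf s  => l = (List.range l.length).map s
  | Pref.complete l,  Trc.term l' => l' = l
  | Pref.complete _,  Trc.inf _   => False

/-- An observation (finite set of finite prefixes) is a prefix of a behavior. -/
def obsLe {E : Type} (o : Finset (Pref E)) (b : Set (Trc E)) : Prop :=
  ∀ m ∈ o, ∃ t ∈ b, prefOf m t

/-- Direction of an event: input or output. -/
inductive Dir : Type where
  | input : Dir
  | output : Dir
deriving DecidableEq

/-- Security level of an event: public or secret. -/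
inductive Lvl : Type where
  | pub : Lvl
  | sec : Lvl
deriving DecidableEq

/-- Events: a direction, a security level, and a natural-number value. -/
abbrev Ev : Type := Dir × Lvl × ℕ

/-- The sublist of public input events. -/
def pubInputs (l : List Ev) : List Ev :=
  l.filter fun e => decide (e.1 = Dir.input ∧ e.2.1 = Lvl.pub)

/-- The sublist of public events. -/
def pubEvents (l : List Ev) : List Ev :=
  l.filter fun e => decide (e.2.1 = Lvl.pub)

/-- Termination-insensitive noninterference: for any two terminated traces in
the behavior agreeing on public inputs, the public events agree. -/
def TINI : Set (Set (Trc Ev)) :=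
  { b | ∀ l1 l2 : List Ev, Trc.term l1 ∈ b → Trc.term l2 ∈ b →
        pubInputs l1 = pubInputs l2 → pubEvents l1 = pubEvents l2 }

/-- A terminated trace is in a behavior iff the behavior matches its complete prefix. -/
theorem exists_complete_prefOf_iff {E : Type} {b : Set (Trc E)} {l : List E} :
    (∃ t ∈ b, prefOf (Pref.complete l) t) ↔ Trc.term l ∈ b := by
  constructor
  · rintro ⟨_ | _, ht, h⟩
    · exact h ▸ ht
    · exact h.elim
  · exact fun h => ⟨_, h, rfl⟩

/-- TINI is 2-hypersafety. -/
theorem tini_two_hypersafety :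
    ∀ b : Set (Trc Ev), b ∉ TINI →
      ∃ o : Finset (Pref Ev), o.card ≤ 2 ∧ obsLe o b ∧
        ∀ b' : Set (Trc Ev), obsLe o b' → b' ∉ TINI := by
  intro b hb
  simp only [TINI, Set.mem_ofPred_eq, not_forall] at hb
  obtain ⟨l1, l2, h1, h2, hin, hne⟩ := hb
  refine ⟨{Pref.complete l1, Pref.complete l2}, Finset.card_le_two, ?_, ?_⟩
  · simpa [obsLe, exists_complete_prefOf_iff] using ⟨h1, h2⟩
  · intro b' hb' hT
    have h : Trc.term l1 ∈ b' ∧ Trc.term l2 ∈ b' := by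
      simpa [obsLe, exists_complete_prefOf_iff] using hb'
    exact hne (hT l1 l2 h.1 h.2 hin)
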